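/- Let (W,S) be a finitely generated Coxeter system with Cayley graph Λ(W,S). Suppose α is an edge path in Λ that is geodesic with respect to a set 𝒬 of pairwise parallel walls (i.e., α crosses each wall of 𝒬 either 0 or 1 times). If a subpath of α is replaced by a geodesic edge path with the same endpoints, then the resulting edge path is again geodesic with respect to 𝒬. -/

import Mathlib

/-!
Common definitions: Cayley graph of a Coxeter system, walls, sides,
bracket numbers, edge paths, quasi-geodesics, tracking.
-/

namespace CoxTrack

variable {B : Type*} {W : Type*} [Group W] {M : CoxeterMatrix B}

/-- The word metric on the Cayley graph `Λ(W,S)`: `d u v = ℓ(u⁻¹ v)`. -/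
noncomputable def d (cs : CoxeterSystem M W) (u v : W) : ℕ := cs.length (u⁻¹ * v)

/-- `u` and `v` are adjacent vertices (endpoints of a common edge) of `Λ(W,S)`. -/
def Adj (cs : CoxeterSystem M W) (u v : W) : Prop := ∃ i : B, v = u * cs.simple i

/-- The edge with endpoints `u` and `v` belongs to the wall of the reflection `t`
(i.e. `t` fixes this edge setwise, interchanging its endpoints). -/
def EdgeInWall (cs : CoxeterSystem M W) (t u v : W) : Prop :=
  Adj cs u v ∧ t * u = v

/-- `v` is a vertex of `Q̄`, the union of the edges of the wall of the reflection `t`. -/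
def InWallBar (cs : CoxeterSystem M W) (t v : W) : Prop :=
  ∃ i : B, t * v = v * cs.simple i

/-- Vertices `u` and `v` lie on the same side of the wall of the reflection `t`. -/
def SameSide (cs : CoxeterSystem M W) (t u v : W) : Prop :=
  (cs.length (t * u) < cs.length u ↔ cs.length (t * v) < cs.length v)

/-- The wall of the reflection `t` separates the vertices `u` and `v`. -/
def SeparatesPts (cs : CoxeterSystem M W) (t u v : W) : Prop := ¬ SameSide cs t u v

/-- The walls of the reflections `t` and `t'` are parallel: they are distinct and
all edges of each one lie on one side of the other. -/
def Parallel (cs : CoxeterSystem M W) (t t' : W) : Prop :=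
  t ≠ t' ∧ (∀ u v, InWallBar cs t' u → InWallBar cs t' v → SameSide cs t u v)
         ∧ (∀ u v, InWallBar cs t u → InWallBar cs t v → SameSide cs t' u v)

/-- The walls of the reflections `t` and `t'` cross (they are distinct and not parallel). -/
def Crosses (cs : CoxeterSystem M W) (t t' : W) : Prop := t ≠ t' ∧ ¬ Parallel cs t t'

/-- The wall of the reflection `r` separates `Q̄` (for the wall of the reflection `t`)
from the vertex `p`. -/
def SepWallFromPt (cs : CoxeterSystem M W) (r t p : W) : Prop :=
  ∀ v, InWallBar cs t v → SeparatesPts cs r v p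

/-- The distance from the vertex `p` to `Q̄` (the wall of the reflection `t`),
measured to the nearest vertex of `Q̄`. -/
noncomputable def wallDist (cs : CoxeterSystem M W) (t p : W) : ℕ :=
  sInf {n : ℕ | ∃ v, InWallBar cs t v ∧ d cs p v = n}

/-- `v 0, v 1, …, v n` are the consecutive vertices of an edge path of length `n` in `Λ(W,S)`. -/
def IsPath (cs : CoxeterSystem M W) (v : ℕ → W) (n : ℕ) : Prop :=
  ∀ k, k < n → Adj cs (v k) (v (k+1))

/-- `v 0, …, v n` are the consecutive vertices of a geodesic edge path of length `n`. -/
def IsGeodesic (cs : CoxeterSystem M W) (v : ℕ → W) (n : ℕ) : Prop :=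
  IsPath cs v n ∧ d cs (v 0) (v n) = n

/-- `v 0, v 1, …` are the consecutive vertices of an edge path ray. -/
def IsRay (cs : CoxeterSystem M W) (v : ℕ → W) : Prop := ∀ k, Adj cs (v k) (v (k+1))

/-- A geodesic edge path ray. -/
def IsGeodesicRay (cs : CoxeterSystem M W) (v : ℕ → W) : Prop :=
  IsRay cs v ∧ ∀ j k, j ≤ k → d cs (v j) (v k) = k - j

/-- `…, v (-1), v 0, v 1, …` are the consecutive vertices of an edge path line. -/
def IsLine (cs : CoxeterSystem M W) (v : ℤ → W) : Prop := ∀ k : ℤ, Adj cs (v k) (v (k+1))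

/-- A geodesic edge path line. -/
def IsGeodesicLine (cs : CoxeterSystem M W) (v : ℤ → W) : Prop :=
  IsLine cs v ∧ ∀ j k : ℤ, j ≤ k → (d cs (v j) (v k) : ℤ) = k - j

/-- The set of (reflections of) walls bracketing the vertex `v k` of the edge path
`v 0, …, v n`: walls containing an edge of the path before `v k` and an edge after `v k`. -/
def Brackets (cs : CoxeterSystem M W) (v : ℕ → W) (n k : ℕ) : Set W :=
  {t | ∃ j m, j < k ∧ k ≤ m ∧ m < n ∧
      EdgeInWall cs t (v j) (v (j+1)) ∧ EdgeInWall cs t (v m) (v (m+1))}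

/-- The set of walls bracketing the vertex `v k` of the edge path ray `v`. -/
def BracketsRay (cs : CoxeterSystem M W) (v : ℕ → W) (k : ℕ) : Set W :=
  {t | ∃ j m, j < k ∧ k ≤ m ∧
      EdgeInWall cs t (v j) (v (j+1)) ∧ EdgeInWall cs t (v m) (v (m+1))}

/-- The set of walls bracketing the vertex `v k` of the edge path line `v`. -/
def BracketsLine (cs : CoxeterSystem M W) (v : ℤ → W) (k : ℤ) : Set W :=
  {t | ∃ j m : ℤ, j < k ∧ k ≤ m ∧
      EdgeInWall cs t (v j) (v (j+1)) ∧ EdgeInWall cs t (v m) (v (m+1))}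

/-- The edge path `v 0, …, v n` is a `(lam, eps)`-quasi-geodesic. -/
def IsQG (cs : CoxeterSystem M W) (lam eps : ℝ) (v : ℕ → W) (n : ℕ) : Prop :=
  IsPath cs v n ∧ ∀ j k, j ≤ n → k ≤ n →
    |(j : ℝ) - (k : ℝ)| ≤ lam * (d cs (v j) (v k) : ℝ) + eps

/-- The edge path ray `v` is a `(lam, eps)`-quasi-geodesic. -/
def IsQGRay (cs : CoxeterSystem M W) (lam eps : ℝ) (v : ℕ → W) : Prop :=
  IsRay cs v ∧ ∀ j k : ℕ, |(j : ℝ) - (k : ℝ)| ≤ lam * (d cs (v j) (v k) : ℝ) + eps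

/-- The edge path line `v` is a `(lam, eps)`-quasi-geodesic. -/
def IsQGLine (cs : CoxeterSystem M W) (lam eps : ℝ) (v : ℤ → W) : Prop :=
  IsLine cs v ∧ ∀ j k : ℤ, |(j : ℝ) - (k : ℝ)| ≤ lam * (d cs (v j) (v k) : ℝ) + eps

/-- `P` is a Parallel Wall function for `(W,S)`: for each positive integer `n`, every wall `Q`
and every vertex `p` at distance at least `P n` from `Q̄`, there are `n` distinct pairwise
parallel walls separating `Q̄` from `p`. -/
def IsParallelWallFn (cs : CoxeterSystem M W) (P : ℕ → ℕ) : Prop :=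
  ∀ n : ℕ, 0 < n → ∀ t p : W, cs.IsReflection t → P n ≤ wallDist cs t p →
    ∃ T : Finset W, T.card = n ∧ (∀ r ∈ T, cs.IsReflection r) ∧
      (∀ r ∈ T, ∀ r' ∈ T, r ≠ r' → Parallel cs r r') ∧
      (∀ r ∈ T, SepWallFromPt cs r t p)

/-- `w 0, …, w m` (with distinguished approximation vertices `w (c 0), …, w (c n)`)
is an `L`-approximation of the edge path `v 0, …, v n`: it is an edge path with the
same endpoints, the segment from `w (c i)` to `w (c (i+1))` is geodesic, and the
approximation vertex `w (c i)` is within `L` of `v i`. -/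
def IsApprox (cs : CoxeterSystem M W) (L : ℕ) (v : ℕ → W) (n : ℕ)
    (w : ℕ → W) (m : ℕ) (c : ℕ → ℕ) : Prop :=
  IsPath cs w m ∧ c 0 = 0 ∧ c n = m ∧ (∀ i, i < n → c i ≤ c (i+1)) ∧
  w 0 = v 0 ∧ w m = v n ∧
  (∀ i, i ≤ n → d cs (w (c i)) (v i) ≤ L) ∧
  (∀ i, i < n → d cs (w (c i)) (w (c (i+1))) = c (i+1) - c i)

section SideFunction

variable (cs : CoxeterSystem M W)

open scoped Classical in
/-- The action of the simple reflection `s i` on `W × ZMod 2`: it conjugates the first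
coordinate, and changes the second one exactly when the first is `s i`. -/
noncomputable def simpleFlip (i : B) : Function.End (W × ZMod 2) :=
  fun x ↦ (cs.simple i * x.1 * cs.simple i, x.2 + if x.1 = cs.simple i then 1 else 0)

lemma pow_mul_simple_mul_pow (i j : B) (k : ℕ) :
    (cs.simple i * cs.simple j) ^ k * cs.simple j * (cs.simple i * cs.simple j) ^ k =
      cs.simple j := by
  induction k with
  | zero => simp
  | succ k ih =>
    calc _ = (cs.simple i * cs.simple j) ^ k *
          (cs.simple i * cs.simple j * cs.simple j * cs.simple i * cs.simple j) *
          (cs.simple i * cs.simple j) ^ k := by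
            rw [pow_succ]; nth_rw 2 [← pow_succ]; rw [pow_succ']; simp only [mul_assoc]
      _ = cs.simple j := by simpa using ih

open scoped Classical in
lemma simpleFlip_mul_pow_apply (i j : B) (k : ℕ) (t : W) (e : ZMod 2) :
    ((simpleFlip cs i * simpleFlip cs j) ^ k) (t, e) =
      ((cs.simple i * cs.simple j) ^ k * t * ((cs.simple i * cs.simple j) ^ k)⁻¹,
        e + ∑ r ∈ Finset.range (2 * k),
          if t = cs.simple j * (cs.simple i * cs.simple j) ^ r then 1 else 0) := by
  induction k with
  | zero => simp [Function.End.one_def]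
  | succ k ih =>
    rw [pow_succ', show ∀ F G : Function.End (W × ZMod 2), (F * G) (t, e) = F (G (t, e)) from
      fun _ _ ↦ rfl, ih]
    have key := pow_mul_simple_mul_pow cs i j k
    set x := cs.simple i * cs.simple j with hx
    have h₁ : x ^ k * t * (x ^ k)⁻¹ = cs.simple j ↔ t = cs.simple j * x ^ (2 * k) := by
      rw [mul_inv_eq_iff_eq_mul, ← mul_right_inj (x ^ k) (b := t), two_mul, pow_add,
        ← mul_assoc, ← mul_assoc, key]
    have h₂ : cs.simple j * (x ^ k * t * (x ^ k)⁻¹) * cs.simple j = cs.simple i ↔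
        t = cs.simple j * x ^ (2 * k + 1) := by
      have hconj : cs.simple j * (x ^ k * t * (x ^ k)⁻¹) * cs.simple j = cs.simple i ↔
          x ^ k * t * (x ^ k)⁻¹ = cs.simple j * x := by
        rw [← mul_left_inj (cs.simple j), cs.simple_mul_simple_cancel_right,
          ← mul_right_inj (cs.simple j), cs.simple_mul_simple_cancel_left]
      rw [hconj, mul_inv_eq_iff_eq_mul, ← mul_right_inj (x ^ k) (b := t),
        show 2 * k + 1 = k + (k + 1) by ring, pow_add, ← mul_assoc (x ^ k),
        ← mul_assoc (x ^ k * cs.simple j), key, pow_succ', mul_assoc]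
    rw [show 2 * (k + 1) = 2 * k + 1 + 1 by ring, Finset.sum_range_succ, Finset.sum_range_succ,
      pow_succ']
    refine Prod.ext ?_ ?_
    · change cs.simple i * (cs.simple j * (x ^ k * t * (x ^ k)⁻¹) * cs.simple j) * cs.simple i = _
      simp [hx, mul_assoc]
    · change e + _ + (if x ^ k * t * (x ^ k)⁻¹ = cs.simple j then (1 : ZMod 2) else 0) +
        (if cs.simple j * (x ^ k * t * (x ^ k)⁻¹) * cs.simple j = cs.simple i then 1 else 0) = _
      simp only [h₁, h₂]
      ring

lemma isLiftable_simpleFlip : M.IsLiftable (simpleFlip cs) := by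
  classical
  intro i j
  funext ⟨t, e⟩
  rw [simpleFlip_mul_pow_apply, two_mul, Finset.sum_range_add]
  simp only [pow_add, cs.simple_mul_simple_pow, one_mul, inv_one, mul_one, CharTwo.add_self_eq_zero,
    add_zero]
  rfl

open scoped Classical in
/-- For each `t` there is a `ZMod 2`-valued function of the vertices of the Cayley graph that
changes along exactly those edges whose endpoints are interchanged by `t`. -/
lemma exists_sideFunction (t : W) :
    ∃ c : W → ZMod 2, ∀ (x : W) (i : B),
      c (x * cs.simple i) = c x + if t * x = x * cs.simple i then 1 else 0 := by
  let φ := cs.lift ⟨simpleFlip cs, isLiftable_simpleFlip cs⟩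
  have hs (i : B) : φ (cs.simple i) = simpleFlip cs i := cs.lift_apply_simple _ i
  have hmul (a b : W) (y : W × ZMod 2) : φ (a * b) y = φ a (φ b y) := by rw [map_mul]; rfl
  have hfst (w : W) : ∀ y : W × ZMod 2, (φ w y).1 = w * y.1 * w⁻¹ := by
    induction w using cs.simple_induction_left with
    | one => intro y; rw [map_one]; simp [Function.End.one_def]
    | mul_simple_left w i ih =>
      intro y
      rw [hmul, hs]
      simp [simpleFlip, ih, mul_assoc]
  refine ⟨fun x ↦ (φ x⁻¹ (t, 0)).2, fun x i ↦ ?_⟩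
  have h : (φ x⁻¹ (t, 0)).1 = cs.simple i ↔ t * x = x * cs.simple i := by
    rw [hfst, inv_inv, mul_assoc, inv_mul_eq_iff_eq_mul]
  simp only [mul_inv_rev, cs.inv_simple, hmul, hs, simpleFlip, h]

end SideFunction

section Crossings

variable {cs : CoxeterSystem M W}

open scoped Classical in
/-- The number of times the edge path `v 0, …, v n` crosses the wall of the reflection `t`. -/
noncomputable def crossings (cs : CoxeterSystem M W) (t : W) (v : ℕ → W) (n : ℕ) : ℕ :=
  Nat.count (fun k ↦ EdgeInWall cs t (v k) (v (k + 1))) n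

lemma ncard_edgeInWall_eq_crossings (t : W) (v : ℕ → W) (n : ℕ) :
    {k | k < n ∧ EdgeInWall cs t (v k) (v (k + 1))}.ncard = crossings cs t v n := by
  classical
  rw [crossings, Nat.count_eq_card_filter_range, ← Set.ncard_coe_finset]
  simp

lemma crossings_add (t : W) (v : ℕ → W) (m n : ℕ) :
    crossings cs t v (m + n) = crossings cs t v m + crossings cs t (fun k ↦ v (m + k)) n := by
  classical
  simp only [crossings, Nat.count_add, add_assoc]

lemma crossings_congr {t : W} {v w : ℕ → W} {n : ℕ} (h : ∀ k ≤ n, v k = w k) :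
    crossings cs t v n = crossings cs t w n := by
  classical
  simp only [← ncard_edgeInWall_eq_crossings]
  congr 1
  ext k
  simp only [Set.mem_ofPred_eq]
  refine and_congr_right fun hk ↦ ?_
  rw [h k hk.le, h (k + 1) hk]

open scoped Classical in
lemma crossings_cast_zmod_two {t : W} {c : W → ZMod 2}
    (hc : ∀ (x : W) (i : B),
      c (x * cs.simple i) = c x + if t * x = x * cs.simple i then 1 else 0)
    {v : ℕ → W} {n : ℕ} (hv : IsPath cs v n) :
    (crossings cs t v n : ZMod 2) = c (v n) - c (v 0) := by
  induction n with
  | zero => simp [crossings]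
  | succ n ih =>
    have hstep : crossings cs t v (n + 1) = crossings cs t v n +
        if EdgeInWall cs t (v n) (v (n + 1)) then 1 else 0 := Nat.count_succ _ n
    obtain ⟨i, hi⟩ := hv n n.lt_succ_self
    have hiff : EdgeInWall cs t (v n) (v (n + 1)) ↔ t * v n = v n * cs.simple i := by
      rw [EdgeInWall, hi]; exact and_iff_right ⟨i, rfl⟩
    simp only [hiff] at hstep
    rw [hstep, Nat.cast_add, ih fun k hk ↦ hv k (hk.trans n.lt_succ_self), hi, hc]
    simp only [Nat.cast_ite, Nat.cast_one, Nat.cast_zero]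
    ring

/-- Two edge paths with the same endpoints cross each wall equally often modulo `2`. -/
lemma crossings_modEq_two {t : W} {v w : ℕ → W} {m n : ℕ} (hv : IsPath cs v m)
    (hw : IsPath cs w n) (h₀ : v 0 = w 0) (h₁ : v m = w n) :
    crossings cs t v m ≡ crossings cs t w n [MOD 2] := by
  obtain ⟨c, hc⟩ := exists_sideFunction cs t
  rw [← ZMod.natCast_eq_natCast_iff, crossings_cast_zmod_two hc hv, crossings_cast_zmod_two hc hw,
    h₀, h₁]

lemma d_triangle (x y z : W) : d cs x z ≤ d cs x y + d cs y z := by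
  simpa [d, mul_assoc] using cs.length_mul_le (x⁻¹ * y) (y⁻¹ * z)

lemma d_mul_left (t x y : W) : d cs (t * x) (t * y) = d cs x y := by
  simp [d, mul_assoc]

lemma IsPath.d_le {v : ℕ → W} {n : ℕ} (hv : IsPath cs v n) {j : ℕ} (k : ℕ) (h : j + k ≤ n) :
    d cs (v j) (v (j + k)) ≤ k := by
  induction k with
  | zero => simp [d]
  | succ k ih =>
    obtain ⟨i, hi⟩ := hv (j + k) h
    have hone : d cs (v (j + k)) (v (j + k + 1)) = 1 := by simp [d, hi, cs.length_simple]
    have := d_triangle (cs := cs) (v j) (v (j + k)) (v (j + k + 1))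
    have := ih (by lia)
    rw [← add_assoc]
    lia

lemma IsGeodesic.le_d {v : ℕ → W} {n : ℕ} (hv : IsGeodesic cs v n) {j k : ℕ} (h : j + k ≤ n) :
    k ≤ d cs (v j) (v (j + k)) := by
  have h₁ := hv.1.d_le (j := 0) j (by lia)
  obtain ⟨l, rfl⟩ := Nat.exists_eq_add_of_le h
  have h₂ := hv.1.d_le (j := j + k) l le_rfl
  have h₃ := d_triangle (cs := cs) (v 0) (v j) (v (j + k + l))
  have h₄ := d_triangle (cs := cs) (v j) (v (j + k)) (v (j + k + l))
  have := hv.2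
  rw [zero_add] at h₁
  lia

/-- A geodesic crosses each wall at most once. -/
lemma IsGeodesic.crossings_le_one {t : W} (ht : cs.IsReflection t) {v : ℕ → W} {n : ℕ}
    (hv : IsGeodesic cs v n) : crossings cs t v n ≤ 1 := by
  have hfin : {k | k < n ∧ EdgeInWall cs t (v k) (v (k + 1))}.Finite :=
    (Set.finite_lt_nat n).subset fun _ hk ↦ hk.1
  rw [← ncard_edgeInWall_eq_crossings, Set.ncard_le_one hfin]
  have key (a b : ℕ) (hab : a < b) (hb : b < n) (ha : t * v a = v (a + 1))
      (hb' : t * v b = v (b + 1)) : False := by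
    obtain ⟨k, rfl⟩ := Nat.exists_eq_add_of_le (Nat.succ_le_of_lt hab)
    have ha' : t * v (a + 1) = v a := by rw [← ha, ← mul_assoc, ht.mul_self, one_mul]
    have h₁ := hv.1.d_le (j := a + 1) k hb.le
    have h₂ := hv.le_d (j := a) (k := k + 2) (by lia)
    rw [← d_mul_left t, ha'] at h₁
    rw [show a.succ + k = a + 1 + k from rfl] at hb'
    rw [hb', show a + 1 + k + 1 = a + (k + 2) by ring] at h₁
    lia
  rintro a ⟨ha, -, ha'⟩ b ⟨hb, -, hb'⟩
  rcases lt_trichotomy a b with h | h | h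
  · exact (key a b h hb ha' hb').elim
  · exact h
  · exact (key b a h ha hb' ha').elim

/-- A geodesic crosses a wall at most as often as any edge path with the same endpoints. -/
lemma IsGeodesic.crossings_le {t : W} (ht : cs.IsReflection t) {u w : ℕ → W} {m n : ℕ}
    (hu : IsGeodesic cs u m) (hw : IsPath cs w n) (h₀ : u 0 = w 0) (h₁ : u m = w n) :
    crossings cs t u m ≤ crossings cs t w n := by
  have := crossings_modEq_two (t := t) hu.1 hw h₀ h₁
  have := hu.crossings_le_one ht
  unfold Nat.ModEq at *
  lia

end Crossings

/-- If an edge path `α = v 0, …, v n` is geodesic with respect to a set `Q` of pairwise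
parallel walls (it crosses each wall of `Q` at most once), and the subpath from `v p` to
`v q` is replaced by a geodesic edge path `u` with the same endpoints, then the resulting
edge path is again geodesic with respect to `Q`. -/
theorem clear_lemma {B : Type*} {W : Type*} [Group W] [Finite B]
    {M : CoxeterMatrix B} (cs : CoxeterSystem M W)
    (v : ℕ → W) (n : ℕ) (hpath : IsPath cs v n)
    (Q : Set W) (hwall : ∀ t ∈ Q, cs.IsReflection t)
    (hpar : ∀ t ∈ Q, ∀ t' ∈ Q, t ≠ t' → Parallel cs t t')
    (hgeoQ : ∀ t ∈ Q, {k | k < n ∧ EdgeInWall cs t (v k) (v (k+1))}.ncard ≤ 1)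
    (p q : ℕ) (hpq : p ≤ q) (hqn : q ≤ n)
    (u : ℕ → W) (g : ℕ) (hu : IsGeodesic cs u g) (hu0 : u 0 = v p) (hug : u g = v q) :
    IsPath cs
      (fun k => if k ≤ p then v k else if k ≤ p + g then u (k - p) else v (k - (p + g) + q))
      (p + g + (n - q)) ∧
    ∀ t ∈ Q,
      {k | k < p + g + (n - q) ∧
        EdgeInWall cs t
          ((fun k => if k ≤ p then v k else if k ≤ p + g then u (k - p)
              else v (k - (p + g) + q)) k)
          ((fun k => if k ≤ p then v k else if k ≤ p + g then u (k - p)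
              else v (k - (p + g) + q)) (k+1))}.ncard ≤ 1 := by
  set w : ℕ → W := fun k =>
    if k ≤ p then v k else if k ≤ p + g then u (k - p) else v (k - (p + g) + q) with hw
  have hw₁ (k : ℕ) (hk : k ≤ p) : w k = v k := by simp [hw, hk]
  have hw₂ (k : ℕ) (hk : k ≤ g) : w (p + k) = u k := by
    rcases Nat.eq_zero_or_pos k with rfl | hpos
    · simp [hw, hu0]
    · simp [hw, hk, hpos.ne']
  have hw₃ (k : ℕ) : w (p + g + k) = v (q + k) := by
    rcases Nat.eq_zero_or_pos k with rfl | hpos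
    · rw [add_zero, hw₂ g le_rfl, hug, add_zero]
    · simp [hw, hpos.ne', show ¬ p + g + k ≤ p by lia, add_comm k q]
  refine ⟨fun k hk ↦ ?_, fun t ht ↦ ?_⟩
  · rcases lt_or_ge k p with h | h
    · rw [hw₁ k h.le, hw₁ (k + 1) h]
      exact hpath k (by lia)
    obtain ⟨k, rfl⟩ := Nat.exists_eq_add_of_le h
    rcases lt_or_ge k g with h' | h'
    · rw [add_assoc, hw₂ k h'.le, hw₂ (k + 1) h']
      exact hu.1 k h'
    obtain ⟨k, rfl⟩ := Nat.exists_eq_add_of_le h'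
    rw [← add_assoc, add_assoc (p + g), hw₃, hw₃]
    exact hpath (q + k) (by lia)
  · obtain ⟨r, rfl⟩ := Nat.exists_eq_add_of_le hpq
    obtain ⟨l, rfl⟩ := Nat.exists_eq_add_of_le hqn
    have hold := hgeoQ t ht
    rw [ncard_edgeInWall_eq_crossings, crossings_add, crossings_add] at hold
    rw [ncard_edgeInWall_eq_crossings, Nat.add_sub_cancel_left, crossings_add, crossings_add,
      crossings_congr hw₁, crossings_congr hw₂, crossings_congr fun k _ ↦ hw₃ k]
    have hsub : IsPath cs (fun k ↦ v (p + k)) r := fun k hk ↦ hpath (p + k) (by lia)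
    have := hu.crossings_le (hwall t ht) hsub hu0 hug
    lia

end CoxTrack
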